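/- Let k ≥ 1 be an integer and λ ∈ (0, k+1). Let a, c, f ∈ C¹([−1,1]) with a(0) = 0, (c − a'/2)(x) ≥ γ > 0 on [−1,1], and let 0 < ε ≤ 1. Let u ∈ C^{k+1}([−1,1]) with u(−1) = u(1) = 0 solve −ε u'' + a u' + c u = f on (−1,1) and satisfy the layer bounds |u^{(i)}(x)| ≤ C_u (1 + (ε^{1/2} + |x|)^{λ−i}) for 0 ≤ i ≤ k+1. Let u_N ∈ V^N be the Galerkin finite element solution of degree k on the Liseikin mesh with parameter α satisfying 0 < α ≤ min{λ/(k+1), 1/(2(k+1))}, i.e. B_ε(u_N, v_N) = ∫_{−1}^{1} f v_N for all v_N ∈ V^N. Then there is a constant C, independent of ε and N, such that |||u − u_N|||_ε ≤ C N^{−k}. -/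

import Mathlib

/-- Liseikin's mesh generating function on `[-1,1]`. -/
noncomputable def liseikinPhi (α ε ξ : ℝ) : ℝ :=
  if 0 ≤ ξ then
    (ε ^ (α/2) + ξ * ((1 + ε ^ ((1:ℝ)/2)) ^ α - ε ^ (α/2))) ^ (1/α) - ε ^ ((1:ℝ)/2)
  else
    ε ^ ((1:ℝ)/2) - (ε ^ (α/2) + (-ξ) * ((1 + ε ^ ((1:ℝ)/2)) ^ α - ε ^ (α/2))) ^ (1/α)

/-- The Liseikin mesh points `x_i = φ(i/N, ε)`, `i = -N, …, N`. -/
noncomputable def liseikinX (α ε : ℝ) (N : ℕ) (i : ℤ) : ℝ :=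
  liseikinPhi α ε ((i : ℝ) / N)

/-- The bilinear form `B_ε(v,w) = ε∫ v'w' + ∫ a v' w + ∫ c v w` over `(-1,1)`,
with derivatives taken pointwise (piecewise for mesh functions; the finitely many
mesh points do not affect the integrals). -/
noncomputable def Beps (ε : ℝ) (a c : ℝ → ℝ) (v w : ℝ → ℝ) : ℝ :=
  ε * (∫ y in (-1:ℝ)..1, deriv v y * deriv w y)
    + (∫ y in (-1:ℝ)..1, a y * deriv v y * w y)
    + (∫ y in (-1:ℝ)..1, c y * v y * w y)

/-- The energy norm `|||v|||_ε = (ε∫ (v')² + ∫ v²)^{1/2}` over `(-1,1)`. -/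
noncomputable def energyNorm (ε : ℝ) (v : ℝ → ℝ) : ℝ :=
  Real.sqrt (ε * (∫ y in (-1:ℝ)..1, (deriv v y)^2) + ∫ y in (-1:ℝ)..1, (v y)^2)

/-- Membership in `V^N`: continuous on `[-1,1]`, vanishing at `±1`, and a
polynomial of degree at most `k` on every mesh interval `[x_{i-1}, x_i]`. -/
def MemVN (x : ℤ → ℝ) (N k : ℕ) (v : ℝ → ℝ) : Prop :=
  ContinuousOn v (Set.Icc (-1) 1) ∧ v (-1) = 0 ∧ v 1 = 0 ∧
  ∀ i : ℤ, -(N:ℤ) < i → i ≤ N → ∃ p : Polynomial ℝ, p.natDegree ≤ k ∧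
    ∀ y ∈ Set.Icc (x (i-1)) (x i), v y = p.eval y

/-- A real polynomial has an antiderivative with a prescribed value at a point. -/
lemma Polynomial.exists_derivative_eq (q : Polynomial ℝ) (n : ℕ) (hq : q.natDegree ≤ n)
    (a A : ℝ) :
    ∃ P : Polynomial ℝ, P.derivative = q ∧ P.natDegree ≤ n + 1 ∧ P.eval a = A := by
  obtain ⟨P, hP, hd⟩ : ∃ P : Polynomial ℝ, P.derivative = q ∧ P.natDegree ≤ n + 1 := by
    refine ⟨∑ i ∈ Finset.range (n + 1),
      Polynomial.C (q.coeff i / (i + 1)) * Polynomial.X ^ (i + 1), ?_, ?_⟩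
    · conv_rhs => rw [q.as_sum_range' (n + 1) (by omega)]
      rw [Polynomial.derivative_sum]
      refine Finset.sum_congr rfl fun i _ => ?_
      have : (i : ℝ) + 1 ≠ 0 := by positivity
      rw [Polynomial.derivative_C_mul_X_pow, Polynomial.C_mul_X_pow_eq_monomial]
      simp only [Nat.add_sub_cancel]
      congr 1
      push_cast
      field_simp
    · refine Polynomial.natDegree_sum_le_of_forall_le _ _ fun i hi => ?_
      refine (Polynomial.natDegree_C_mul_X_pow_le _ _).trans ?_
      have := Finset.mem_range.1 hi
      omega
  refine ⟨P + Polynomial.C (A - P.eval a), by simp [hP], ?_, by simp⟩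
  exact (Polynomial.natDegree_add_C).le.trans hd

/-- Taylor-type approximation of `g 0`, where `g (i + 1)` is the derivative of `g i`. -/
lemma exists_polynomial_approx (n : ℕ) : ∀ (g : ℕ → ℝ → ℝ) (p q M : ℝ), p ≤ q →
    (∀ i ≤ n, ∀ y ∈ Set.Icc p q, HasDerivWithinAt (g i) (g (i + 1) y) (Set.Icc p q) y) →
    (∀ y ∈ Set.Icc p q, |g (n + 1) y| ≤ M) →
    ∃ P : Polynomial ℝ, P.natDegree ≤ n ∧ P.eval p = g 0 p ∧
      ∀ y ∈ Set.Icc p q, |g 0 y - P.eval y| ≤ M * (q - p) ^ (n + 1) ∧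
        |g 1 y - P.derivative.eval y| ≤ M * (q - p) ^ n := by
  have key : ∀ (f f' : ℝ → ℝ) (p q B : ℝ), p ≤ q → f p = 0 →
      (∀ y ∈ Set.Icc p q, HasDerivWithinAt f (f' y) (Set.Icc p q) y) →
      (∀ y ∈ Set.Icc p q, |f' y| ≤ B) → ∀ y ∈ Set.Icc p q, |f y| ≤ B * (q - p) := by
    intro f f' p q B hpq h0 hd hB y hy
    have hp : p ∈ Set.Icc p q := ⟨le_rfl, hpq⟩
    have h := (convex_Icc p q).norm_image_sub_le_of_norm_hasDerivWithin_le hd hB hp hy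
    rw [h0, sub_zero, Real.norm_eq_abs, Real.norm_eq_abs, abs_of_nonneg (by linarith [hy.1] : 0 ≤ y - p)] at h
    have hB0 : 0 ≤ B := (abs_nonneg _).trans (hB p hp)
    exact h.trans (mul_le_mul_of_nonneg_left (by linarith [hy.2]) hB0)
  induction n with
  | zero =>
    intro g p q M hpq hg hM
    refine ⟨Polynomial.C (g 0 p), by simp, by simp, fun y hy => ⟨?_, ?_⟩⟩
    · have := key (fun y => g 0 y - g 0 p) (g 1) p q M hpq (by simp)
        (fun y hy => (hg 0 le_rfl y hy).sub_const _) hM y hy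
      simpa using this
    · simpa using hM y hy
  | succ n ih =>
    intro g p q M hpq hg hM
    obtain ⟨Q, hQd, -, hQ⟩ := ih (fun i => g (i + 1)) p q M hpq
      (fun i hi y hy => hg (i + 1) (by omega) y hy) hM
    obtain ⟨P, hP, hPd, hPp⟩ := Q.exists_derivative_eq n hQd p (g 0 p)
    refine ⟨P, hPd, hPp, fun y hy => ⟨?_, ?_⟩⟩
    · have := key (fun y => g 0 y - P.eval y) (fun y => g 1 y - Q.eval y) p q
        (M * (q - p) ^ (n + 1)) hpq (by simp [hPp])
        (fun y hy => (hg 0 (by omega) y hy).sub (hP ▸ (P.hasDerivAt y).hasDerivWithinAt))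
        (fun y hy => (hQ y hy).1) y hy
      rw [pow_succ _ (n + 1), ← mul_assoc]
      exact this
    · rw [hP]
      exact (hQ y hy).1

/-- Polynomial approximation matching both endpoint values. -/
lemma exists_polynomial_interp (n : ℕ) (hn : 1 ≤ n) (g : ℕ → ℝ → ℝ) (p q M : ℝ) (hpq : p < q)
    (hg : ∀ i ≤ n, ∀ y ∈ Set.Icc p q, HasDerivWithinAt (g i) (g (i + 1) y) (Set.Icc p q) y)
    (hM : ∀ y ∈ Set.Icc p q, |g (n + 1) y| ≤ M) :
    ∃ P : Polynomial ℝ, P.natDegree ≤ n ∧ P.eval p = g 0 p ∧ P.eval q = g 0 q ∧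
      ∀ y ∈ Set.Icc p q, |g 0 y - P.eval y| ≤ 2 * M * (q - p) ^ (n + 1) ∧
        |g 1 y - P.derivative.eval y| ≤ 2 * M * (q - p) ^ n := by
  obtain ⟨T, hTd, hTp, hT⟩ := exists_polynomial_approx n g p q M hpq.le hg hM
  have hh : 0 < q - p := by linarith
  set d := (g 0 q - T.eval q) / (q - p) with hd
  have hdq : d * (q - p) = g 0 q - T.eval q := by rw [hd]; field_simp
  have hdM : |d| ≤ M * (q - p) ^ n := by
    rw [hd, abs_div, abs_of_pos hh, div_le_iff₀ hh, mul_assoc, ← pow_succ]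
    exact (hT q ⟨hpq.le, le_rfl⟩).1
  have hlin : (Polynomial.C d * (Polynomial.X - Polynomial.C p)).natDegree ≤ n := by
    refine (Polynomial.natDegree_C_mul_le _ _).trans ?_
    rw [Polynomial.natDegree_X_sub_C]
    exact hn
  refine ⟨T + Polynomial.C d * (Polynomial.X - Polynomial.C p),
    (Polynomial.natDegree_add_le _ _).trans (max_le hTd hlin), by simp [hTp], by simp [hdq],
    fun y hy => ⟨?_, ?_⟩⟩
  · have h1 := (hT y hy).1
    have h2 : |d * (y - p)| ≤ M * (q - p) ^ (n + 1) := by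
      rw [abs_mul, abs_of_nonneg (by linarith [hy.1] : 0 ≤ y - p), pow_succ, ← mul_assoc]
      exact mul_le_mul hdM (by linarith [hy.2]) (by linarith [hy.1])
        ((abs_nonneg _).trans hdM)
    have h3 : g 0 y - (T + Polynomial.C d * (Polynomial.X - Polynomial.C p)).eval y
        = (g 0 y - T.eval y) - d * (y - p) := by simp; ring
    rw [h3]
    refine (abs_sub _ _).trans ?_
    linarith
  · have h1 := (hT y hy).2
    have h3 : g 1 y - (T + Polynomial.C d * (Polynomial.X - Polynomial.C p)).derivative.eval y
        = (g 1 y - T.derivative.eval y) - d := by simp; ring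
    rw [h3]
    refine (abs_sub _ _).trans ?_
    linarith

/-- The linear interpolant, estimated only through the size of the interpolated function. -/
lemma exists_polynomial_linear_interp (f : ℝ → ℝ) (p q U : ℝ) (hpq : p < q)
    (hU : ∀ y ∈ Set.Icc p q, |f y| ≤ U) :
    ∃ P : Polynomial ℝ, P.natDegree ≤ 1 ∧ P.eval p = f p ∧ P.eval q = f q ∧
      ∀ y ∈ Set.Icc p q, |P.eval y| ≤ 3 * U ∧ |P.derivative.eval y| * (q - p) ≤ 2 * U := by
  have hh : 0 < q - p := by linarith
  have hp := hU p ⟨le_rfl, hpq.le⟩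
  have hq := hU q ⟨hpq.le, le_rfl⟩
  set d := (f q - f p) / (q - p) with hd
  have hdq : d * (q - p) = f q - f p := by rw [hd]; field_simp
  have hdU : |d| * (q - p) ≤ 2 * U := by
    have : |d| * (q - p) = |f q - f p| := by rw [← hdq, abs_mul, abs_of_pos hh]
    rw [this]
    refine (abs_sub _ _).trans ?_
    linarith
  refine ⟨Polynomial.C (f p) + Polynomial.C d * (Polynomial.X - Polynomial.C p), ?_, by simp,
    by simp [hdq], fun y hy => ⟨?_, by simpa using hdU⟩⟩
  · refine (Polynomial.natDegree_add_le _ _).trans (max_le (by simp) ?_)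
    refine (Polynomial.natDegree_C_mul_le _ _).trans ?_
    rw [Polynomial.natDegree_X_sub_C]
  · have h2 : |d * (y - p)| ≤ |d| * (q - p) := by
      rw [abs_mul, abs_of_nonneg (by linarith [hy.1] : 0 ≤ y - p)]
      exact mul_le_mul_of_nonneg_left (by linarith [hy.2]) (abs_nonneg _)
    have h3 : (Polynomial.C (f p) + Polynomial.C d * (Polynomial.X - Polynomial.C p)).eval y
        = f p + d * (y - p) := by simp
    rw [h3]
    refine (abs_add_le _ _).trans ?_
    linarith

/-- On the nonnegative side, mesh points are shifted `1/α`-th powers of equidistant points. -/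
lemma liseikinX_of_nonneg (α ε : ℝ) (N : ℕ) {i : ℤ} (hi : 0 ≤ i) :
    liseikinX α ε N i =
      (ε ^ (α/2) + ((i : ℝ) / N) * ((1 + ε ^ ((1:ℝ)/2)) ^ α - ε ^ (α/2))) ^ (1/α)
        - ε ^ ((1:ℝ)/2) := by
  have : (0 : ℝ) ≤ (i : ℝ) / N := by positivity
  rw [liseikinX, liseikinPhi, if_pos this]

/-- Secant slope bound for power functions with exponent at least one. -/
lemma rpow_sub_rpow_le {p s t : ℝ} (hp : 1 ≤ p) (hs : 0 < s) (hst : s ≤ t) :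
    t ^ p - s ^ p ≤ p * t ^ (p - 1) * (t - s) := by
  have ht : 0 < t := hs.trans_le hst
  have h := one_add_mul_self_le_rpow_one_add (s := s / t - 1)
    (by have : 0 < s / t := by positivity
        linarith) hp
  have h1 : (1 + (s / t - 1)) ^ p = s ^ p / t ^ p := by
    rw [add_sub_cancel, Real.div_rpow hs.le ht.le]
  have htp : 0 < t ^ p := by positivity
  rw [h1, le_div_iff₀ htp] at h
  have h2 : t ^ (p - 1) = t ^ p / t := Real.rpow_sub_one ht.ne' p
  rw [h2]
  have : p * (t ^ p / t) * (t - s) = -(p * (s / t - 1)) * t ^ p := by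
    field_simp
    ring
  rw [this]
  linarith

/-- Alternatives for a mesh cell `[p, q]` with layer parameter `e = √ε`: either `e + |y|` is
comparable to a constant on the cell, and the cell is correspondingly small, or the cell touches
the origin, is tiny, and is longer than `e`. -/
def LayerCell (K α δ e : ℝ) (N : ℕ) (p q : ℝ) : Prop :=
  (∃ σ, 0 < σ ∧ σ ≤ 2 ∧ (∀ y ∈ Set.Icc p q, e + |y| ≤ σ ∧ σ ≤ K * (e + |y|)) ∧
    q - p ≤ K * σ ^ (1 - α) / N) ∨
  (e ≤ q - p ∧ ∀ y ∈ Set.Icc p q, |y| ≤ q - p ∧ |y| ≤ K * δ)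

lemma LayerCell.neg {K α δ e : ℝ} {N : ℕ} {p q : ℝ} (h : LayerCell K α δ e N p q) :
    LayerCell K α δ e N (-q) (-p) := by
  have hm : ∀ y ∈ Set.Icc (-q) (-p), -y ∈ Set.Icc p q := fun y hy =>
    ⟨by linarith [hy.2], by linarith [hy.1]⟩
  have hl : -p - -q = q - p := by ring
  rcases h with ⟨σ, h0, h2, h3, h4⟩ | ⟨h1, h2⟩
  · refine Or.inl ⟨σ, h0, h2, fun y hy => ?_, hl ▸ h4⟩
    simpa using h3 (-y) (hm y hy)
  · refine Or.inr ⟨hl ▸ h1, fun y hy => ?_⟩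
    rw [hl]
    simpa using h2 (-y) (hm y hy)

section Mesh

variable {α ε : ℝ} {N : ℕ}

lemma liseikinX_zero (hα : 0 < α) (hε : 0 < ε) : liseikinX α ε N 0 = 0 := by
  rw [liseikinX_of_nonneg α ε N le_rfl]
  have : (ε ^ (α / 2)) ^ (1 / α) = ε ^ ((1 : ℝ) / 2) := by
    rw [← Real.rpow_mul hε.le]
    congr 1
    field_simp
  simp only [Int.cast_zero, zero_div, zero_mul, add_zero, this, sub_self]

lemma liseikinX_natCast_self (hα : 0 < α) (hε : 0 < ε) (hN : 1 ≤ N) :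
    liseikinX α ε N N = 1 := by
  rw [liseikinX_of_nonneg α ε N (by positivity)]
  have hN' : (N : ℝ) ≠ 0 := by positivity
  have he : 0 < ε ^ ((1 : ℝ) / 2) := by positivity
  have : ((1 + ε ^ ((1 : ℝ) / 2)) ^ α) ^ (1 / α) = 1 + ε ^ ((1 : ℝ) / 2) := by
    rw [← Real.rpow_mul (by positivity), mul_one_div_cancel hα.ne', Real.rpow_one]
  rw [Int.cast_natCast, div_self hN', one_mul, add_sub_cancel, this]
  ring

lemma liseikinX_neg (hα : 0 < α) (hε : 0 < ε) (i : ℤ) :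
    liseikinX α ε N (-i) = -liseikinX α ε N i := by
  have key : ∀ j : ℤ, 0 < j → liseikinX α ε N (-j) = -liseikinX α ε N j := by
    intro j hj
    rcases Nat.eq_zero_or_pos N with rfl | hN
    · have h0 := liseikinX_zero (N := 0) hα hε
      simp only [liseikinX, CharP.cast_eq_zero, div_zero] at h0 ⊢
      rw [h0, neg_zero]
    · have hj' : (0 : ℝ) < (j : ℝ) / N := by positivity
      rw [liseikinX_of_nonneg α ε N hj.le, liseikinX, liseikinPhi, if_neg]
      · push_cast
        rw [show -(-(j : ℝ) / N) = (j : ℝ) / N by ring]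
        ring
      · push_cast
        rw [not_le, neg_div]
        linarith
  rcases lt_trichotomy i 0 with h | rfl | h
  · have := key (-i) (by omega)
    rw [neg_neg] at this
    rw [this, neg_neg]
  · rw [neg_zero, liseikinX_zero hα hε, neg_zero]
  · exact key i h

lemma exists_layerCell_of_pos (hα : 0 < α) (hα1 : α ≤ 1) (m : ℕ) (hm : m * α ≤ 1)
    (hε : 0 < ε) (hε1 : ε ≤ 1) (hN : 1 ≤ N) {i : ℤ} (hi : 0 < i) (hiN : i ≤ N) :
    liseikinX α ε N (i - 1) < liseikinX α ε N i ∧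
      LayerCell (2 ^ (1 / α) + 1 / α) α (1 / (N : ℝ) ^ m) (ε ^ ((1 : ℝ) / 2)) N
        (liseikinX α ε N (i - 1)) (liseikinX α ε N i) := by
  have hx := liseikinX_of_nonneg α ε N hi.le
  have hx' := liseikinX_of_nonneg α ε N (i := i - 1) (by omega)
  have hea : ε ^ (α / 2) = (ε ^ ((1 : ℝ) / 2)) ^ α := by
    rw [← Real.rpow_mul hε.le]; congr 1; ring
  rw [hea] at hx hx'
  have he : 0 < ε ^ ((1 : ℝ) / 2) := by positivity
  have he1 : ε ^ ((1 : ℝ) / 2) ≤ 1 := Real.rpow_le_one hε.le hε1 (by norm_num)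
  generalize ε ^ ((1 : ℝ) / 2) = e at *
  set D := (1 + e) ^ α - e ^ α with hD
  have hD0 : 0 < D := sub_pos.2 (Real.rpow_lt_rpow he.le (by linarith) hα)
  have hD1 : D ≤ 1 := by
    have := Real.rpow_add_le_add_rpow zero_le_one he.le hα.le hα1
    rw [Real.one_rpow] at this
    linarith
  have hNr : (1 : ℝ) ≤ N := by exact_mod_cast hN
  have hN0 : (0 : ℝ) < N := by linarith
  have hi1 : (1 : ℝ) ≤ i := by exact_mod_cast hi
  have hiN' : (i : ℝ) ≤ N := by exact_mod_cast hiN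
  push_cast at hx'
  set t := e ^ α + (i : ℝ) / N * D with ht
  set s := e ^ α + ((i : ℝ) - 1) / N * D with hs
  have hts : t - s = D / N := by rw [ht, hs]; field_simp; ring
  have hDN : 0 < D / N := by positivity
  have heα : 0 < e ^ α := by positivity
  have hs0 : e ^ α ≤ s := by
    have : 0 ≤ ((i : ℝ) - 1) / N * D :=
      mul_nonneg (div_nonneg (by linarith) hN0.le) hD0.le
    linarith
  have hs0' : 0 < s := by linarith
  have ht0 : 0 < t := by linarith
  have hP : 1 ≤ 1 / α := (one_le_div hα).2 hα1
  have hP0 : 0 < 1 / α := by linarith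
  have heP : (e ^ α) ^ (1 / α) = e := by
    rw [← Real.rpow_mul he.le, mul_one_div_cancel hα.ne', Real.rpow_one]
  have hsP : e ≤ s ^ (1 / α) := by
    calc e = (e ^ α) ^ (1 / α) := heP.symm
      _ ≤ s ^ (1 / α) := Real.rpow_le_rpow heα.le hs0 hP0.le
  have h2P : (2 : ℝ) ≤ 2 ^ (1 / α) := by
    calc (2 : ℝ) = 2 ^ (1 : ℝ) := (Real.rpow_one _).symm
      _ ≤ 2 ^ (1 / α) := Real.rpow_le_rpow_of_exponent_le (by norm_num) hP
  have hlt : s ^ (1 / α) < t ^ (1 / α) := Real.rpow_lt_rpow hs0'.le (by linarith) hP0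
  rw [hx, hx']
  refine ⟨by linarith, ?_⟩
  rcases le_or_gt (D / N) s with hc | hc
  · refine Or.inl ⟨t ^ (1 / α), by positivity, ?_, fun y hy => ?_, ?_⟩
    · have : t ≤ (1 + e) ^ α := by
        have : (i : ℝ) / N * D ≤ 1 * D :=
          mul_le_mul_of_nonneg_right ((div_le_one hN0).2 hiN') hD0.le
        linarith
      calc t ^ (1 / α) ≤ ((1 + e) ^ α) ^ (1 / α) := Real.rpow_le_rpow ht0.le this hP0.le
        _ = 1 + e := by
          rw [← Real.rpow_mul (by linarith), mul_one_div_cancel hα.ne', Real.rpow_one]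
        _ ≤ 2 := by linarith
    · have hy0 : 0 ≤ y := by linarith [hy.1]
      rw [abs_of_nonneg hy0]
      refine ⟨by linarith [hy.2], ?_⟩
      calc t ^ (1 / α) ≤ (2 * s) ^ (1 / α) := Real.rpow_le_rpow ht0.le (by linarith) hP0.le
        _ = 2 ^ (1 / α) * s ^ (1 / α) := Real.mul_rpow (by norm_num) hs0'.le
        _ ≤ (2 ^ (1 / α) + 1 / α) * (e + y) :=
          mul_le_mul (by linarith) (by linarith [hy.1]) (by positivity) (by positivity)
    · have h1 := rpow_sub_rpow_le hP hs0' (by linarith : s ≤ t)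
      have h2 : t ^ (1 / α - 1) = (t ^ (1 / α)) ^ (1 - α) := by
        rw [← Real.rpow_mul ht0.le]; congr 1; field_simp
      rw [hts, h2] at h1
      have h3 : 1 / α * (t ^ (1 / α)) ^ (1 - α) * (D / N)
          ≤ (2 ^ (1 / α) + 1 / α) * (t ^ (1 / α)) ^ (1 - α) * (1 / N) := by
        gcongr
        linarith
      rw [mul_one_div] at h3
      linarith
  · have hi' : i = 1 := by
      by_contra hne
      have : (2 : ℝ) ≤ i := by
        have : 2 ≤ i := by omega
        exact_mod_cast this
      have : 1 / N * D ≤ ((i : ℝ) - 1) / N * D := by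
        gcongr
        linarith
      have h1 : 1 / N * D = D / N := by ring
      linarith
    have hse : s = e ^ α := by rw [hs, hi']; simp
    have hp : s ^ (1 / α) - e = 0 := by rw [hse, heP, sub_self]
    rw [hp]
    have hte : 2 ^ (1 / α) * e ≤ t ^ (1 / α) := by
      calc 2 ^ (1 / α) * e = (2 * e ^ α) ^ (1 / α) := by
            rw [Real.mul_rpow (by norm_num) heα.le, heP]
        _ ≤ t ^ (1 / α) := Real.rpow_le_rpow (by positivity) (by linarith) hP0.le
    refine Or.inr ⟨by rw [sub_zero]; nlinarith, fun y hy => ?_⟩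
    rw [abs_of_nonneg hy.1]
    refine ⟨by linarith [hy.2], ?_⟩
    have hDN1 : D / N ≤ 1 / N := by gcongr
    have hNm : (N : ℝ) ^ m ≤ (N : ℝ) ^ (1 / α) := by
      rw [← Real.rpow_natCast]
      exact Real.rpow_le_rpow_of_exponent_le hNr ((le_div_iff₀ hα).2 hm)
    have h4 : t ^ (1 / α) ≤ 2 ^ (1 / α) * (1 / (N : ℝ) ^ m) := by
      calc t ^ (1 / α) ≤ (2 * (1 / N)) ^ (1 / α) :=
            Real.rpow_le_rpow ht0.le (by linarith) hP0.le
        _ = 2 ^ (1 / α) * (1 / (N : ℝ) ^ (1 / α)) := by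
          rw [Real.mul_rpow (by norm_num) (by positivity), Real.div_rpow zero_le_one hN0.le,
            Real.one_rpow]
        _ ≤ 2 ^ (1 / α) * (1 / (N : ℝ) ^ m) := by gcongr
    have h5 : 0 ≤ 1 / α * (1 / (N : ℝ) ^ m) := by positivity
    linarith [hy.2]

lemma exists_layerCell (hα : 0 < α) (hα1 : α ≤ 1) (m : ℕ) (hm : m * α ≤ 1)
    (hε : 0 < ε) (hε1 : ε ≤ 1) (hN : 1 ≤ N) {i : ℤ} (hi : -(N : ℤ) < i) (hiN : i ≤ N) :
    liseikinX α ε N (i - 1) < liseikinX α ε N i ∧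
      LayerCell (2 ^ (1 / α) + 1 / α) α (1 / (N : ℝ) ^ m) (ε ^ ((1 : ℝ) / 2)) N
        (liseikinX α ε N (i - 1)) (liseikinX α ε N i) := by
  rcases lt_or_ge 0 i with h | h
  · exact exists_layerCell_of_pos hα hα1 m hm hε hε1 hN h hiN
  · obtain ⟨h1, h2⟩ := exists_layerCell_of_pos hα hα1 m hm hε hε1 hN (i := 1 - i) (by omega) (by omega)
    have e1 : liseikinX α ε N (i - 1) = -liseikinX α ε N (1 - i) := by
      rw [← liseikinX_neg hα hε]; congr 1; ring
    have e2 : liseikinX α ε N i = -liseikinX α ε N (1 - i - 1) := by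
      rw [← liseikinX_neg hα hε]; congr 1; ring
    rw [e1, e2]
    exact ⟨neg_lt_neg h1, h2.neg⟩

end Mesh

/-- On every admissible mesh cell a function with layer-type derivative bounds has an endpoint
interpolating polynomial with a weighted error of order `N ^ (-k)`, except that the error may be
merely bounded in a tiny neighbourhood of the origin. -/
lemma exists_cell_interp (k : ℕ) (hk : 1 ≤ k) (lam α Cu K : ℝ) (hlam : 0 < lam)
    (hlam1 : lam < k + 1) (hα : 0 < α) (hα1 : α * (k + 1) ≤ lam) (hCu : 0 < Cu) (hK : 1 ≤ K) :
    ∃ A : ℝ, 0 < A ∧ ∀ (e δ : ℝ) (N : ℕ) (p q : ℝ) (g : ℕ → ℝ → ℝ), 0 < e → e ≤ 1 → 1 ≤ N →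
      p < q → -1 ≤ p → q ≤ 1 → LayerCell K α δ e N p q →
      (∀ i ≤ k, ∀ y ∈ Set.Icc p q, HasDerivWithinAt (g i) (g (i + 1) y) (Set.Icc p q) y) →
      (∀ i ≤ k + 1, ∀ y ∈ Set.Icc p q, |g i y| ≤ Cu * (1 + (e + |y|) ^ (lam - i))) →
      ∃ P : Polynomial ℝ, P.natDegree ≤ k ∧ P.eval p = g 0 p ∧ P.eval q = g 0 q ∧
        ∀ y ∈ Set.Icc p q, ∃ β : ℝ, (β = A / (N : ℝ) ^ k ∨ (|y| ≤ K * δ ∧ β = A)) ∧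
          |g 0 y - P.eval y| ≤ β ∧ (e + |y|) * |g 1 y - P.derivative.eval y| ≤ β := by
  set r : ℝ := lam - (k + 1) with hr
  have hr0 : r < 0 := by linarith
  set B : ℝ := Cu * (2 ^ (-r) + K ^ (-r)) with hB
  have hB0 : 0 < B := by positivity
  set A₁ : ℝ := 2 * B * K ^ (k + 1) * 2 ^ lam with hA₁
  set A₂ : ℝ := Cu * (2 + 2 ^ lam) + 4 * (Cu * (1 + 2 ^ lam)) with hA₂
  have hA₁0 : 0 < A₁ := by positivity
  have hA₂0 : 0 < A₂ := by positivity
  refine ⟨A₁ + A₂, by positivity, ?_⟩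
  intro e δ N p q g he he1 hN hpq hp hq hcell hg hbd
  have hNr : (1 : ℝ) ≤ N := by exact_mod_cast hN
  have hN0 : (0 : ℝ) < N := by linarith
  have hpow : ∀ σ θ : ℝ, 0 < σ → σ ≤ 2 → 0 ≤ θ → θ ≤ lam → σ ^ θ ≤ 2 ^ lam := by
    intro σ θ h0 h2 hθ hθ'
    exact (Real.rpow_le_rpow h0.le h2 hθ).trans
      (Real.rpow_le_rpow_of_exponent_le (by norm_num) hθ')
  rcases hcell with ⟨σ, hσ0, hσ2, hσ, hh⟩ | ⟨heh, hy⟩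
  · have hM : ∀ y ∈ Set.Icc p q, |g (k + 1) y| ≤ B * σ ^ r := by
      intro y hy
      have hs0 : 0 < e + |y| := by positivity
      have h1 : (e + |y|) ^ r ≤ K ^ (-r) * σ ^ r := by
        have : σ / K ≤ e + |y| := by
          rw [div_le_iff₀ (by linarith)]
          linarith [(hσ y hy).2]
        calc (e + |y|) ^ r ≤ (σ / K) ^ r :=
              Real.rpow_le_rpow_of_nonpos (by positivity) this hr0.le
          _ = K ^ (-r) * σ ^ r := by
              rw [Real.div_rpow hσ0.le (by linarith), Real.rpow_neg (by linarith)]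
              ring
      have h2 : 1 ≤ 2 ^ (-r) * σ ^ r := by
        have : (2 : ℝ) ^ r ≤ σ ^ r := Real.rpow_le_rpow_of_nonpos hσ0 hσ2 hr0.le
        rw [Real.rpow_neg (by norm_num), ← div_eq_inv_mul]
        exact (one_le_div (by positivity)).2 this
      have h3 := hbd (k + 1) le_rfl y hy
      rw [show lam - ((k + 1 : ℕ) : ℝ) = r by rw [hr]; push_cast; ring] at h3
      calc |g (k + 1) y| ≤ Cu * (1 + (e + |y|) ^ r) := h3
        _ ≤ Cu * (2 ^ (-r) * σ ^ r + K ^ (-r) * σ ^ r) := by gcongr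
        _ = B * σ ^ r := by rw [hB]; ring
    obtain ⟨P, hPd, hPp, hPq, hP⟩ := exists_polynomial_interp k hk g p q _ hpq hg hM
    refine ⟨P, hPd, hPp, hPq, fun y hy => ⟨_, Or.inl rfl, ?_, ?_⟩⟩
    · refine (hP y hy).1.trans ?_
      have hexp : σ ^ r * (σ ^ (1 - α)) ^ (k + 1) ≤ 2 ^ lam := by
        rw [← Real.rpow_natCast (σ ^ (1 - α)), ← Real.rpow_mul hσ0.le, ← Real.rpow_add hσ0]
        refine hpow _ _ hσ0 hσ2 ?_ ?_
        · rw [hr]; push_cast; nlinarith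
        · rw [hr]; push_cast; nlinarith
      have hNk : (N : ℝ) ^ k ≤ (N : ℝ) ^ (k + 1) := pow_le_pow_right₀ hNr (by omega)
      calc 2 * (B * σ ^ r) * (q - p) ^ (k + 1)
          ≤ 2 * (B * σ ^ r) * (K * σ ^ (1 - α) / N) ^ (k + 1) := by
            gcongr
        _ = 2 * B * K ^ (k + 1) * (σ ^ r * (σ ^ (1 - α)) ^ (k + 1)) / (N : ℝ) ^ (k + 1) := by
            rw [div_pow, mul_pow]; ring
        _ ≤ 2 * B * K ^ (k + 1) * 2 ^ lam / (N : ℝ) ^ k := by gcongr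
        _ ≤ (A₁ + A₂) / (N : ℝ) ^ k := by gcongr; linarith
    · have hexp : σ * σ ^ r * (σ ^ (1 - α)) ^ k ≤ 2 ^ lam := by
        rw [← Real.rpow_natCast (σ ^ (1 - α)), ← Real.rpow_mul hσ0.le]
        nth_rewrite 1 [← Real.rpow_one σ]
        rw [← Real.rpow_add hσ0, ← Real.rpow_add hσ0]
        have : 0 ≤ α * k := by positivity
        refine hpow _ _ hσ0 hσ2 ?_ ?_
        · rw [hr]; nlinarith
        · rw [hr]; nlinarith
      have hKk : K ^ k ≤ K ^ (k + 1) := pow_le_pow_right₀ hK (by omega)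
      calc (e + |y|) * |g 1 y - P.derivative.eval y|
          ≤ σ * (2 * (B * σ ^ r) * (q - p) ^ k) :=
            mul_le_mul (hσ y hy).1 (hP y hy).2 (abs_nonneg _) hσ0.le
        _ ≤ σ * (2 * (B * σ ^ r) * (K * σ ^ (1 - α) / N) ^ k) := by
            gcongr
        _ = 2 * B * K ^ k * (σ * σ ^ r * (σ ^ (1 - α)) ^ k) / (N : ℝ) ^ k := by
            rw [div_pow, mul_pow]; ring
        _ ≤ 2 * B * K ^ (k + 1) * 2 ^ lam / (N : ℝ) ^ k := by gcongr
        _ ≤ (A₁ + A₂) / (N : ℝ) ^ k := by gcongr; linarith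
  · have hs2 : ∀ y ∈ Set.Icc p q, 0 < e + |y| ∧ e + |y| ≤ 2 := by
      intro y hy
      have : |y| ≤ 1 := abs_le.2 ⟨by linarith [hy.1], by linarith [hy.2]⟩
      exact ⟨by positivity, by linarith⟩
    have hU : ∀ y ∈ Set.Icc p q, |g 0 y| ≤ Cu * (1 + 2 ^ lam) := by
      intro y hy
      refine (hbd 0 (by omega) y hy).trans ?_
      have := hpow _ lam (hs2 y hy).1 (hs2 y hy).2 hlam.le le_rfl
      simp only [Nat.cast_zero, sub_zero]
      gcongr
    obtain ⟨P, hPd, hPp, hPq, hP⟩ := exists_polynomial_linear_interp (g 0) p q _ hpq hU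
    refine ⟨P, hPd.trans hk, hPp, hPq, fun y hy' => ⟨_, Or.inr ⟨(hy y hy').2, rfl⟩, ?_, ?_⟩⟩
    · refine (abs_sub _ _).trans ?_
      have h1 := hU y hy'
      have h2 := (hP y hy').1
      have h3 : 0 < Cu * (2 + 2 ^ lam) := by positivity
      linarith
    · obtain ⟨hs0, hs⟩ := hs2 y hy'
      have h1 : (e + |y|) * |g 1 y| ≤ Cu * (2 + 2 ^ lam) := by
        have h4 := hbd 1 (by omega) y hy'
        rw [Nat.cast_one, Real.rpow_sub_one hs0.ne'] at h4
        have h5 := hpow _ lam hs0 hs hlam.le le_rfl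
        calc (e + |y|) * |g 1 y|
            ≤ (e + |y|) * (Cu * (1 + (e + |y|) ^ lam / (e + |y|))) := by gcongr
          _ = Cu * ((e + |y|) + (e + |y|) ^ lam) := by field_simp
          _ ≤ Cu * (2 + 2 ^ lam) := by gcongr
      have h2 : (e + |y|) * |P.derivative.eval y| ≤ 4 * (Cu * (1 + 2 ^ lam)) := by
        have h4 := (hP y hy').2
        have h5 : e + |y| ≤ 2 * (q - p) := by linarith [(hy y hy').1]
        calc (e + |y|) * |P.derivative.eval y| ≤ 2 * (q - p) * |P.derivative.eval y| := by gcongr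
          _ = 2 * (|P.derivative.eval y| * (q - p)) := by ring
          _ ≤ _ := by linarith
      calc (e + |y|) * |g 1 y - P.derivative.eval y|
          ≤ (e + |y|) * (|g 1 y| + |P.derivative.eval y|) := by
            gcongr
            exact abs_sub _ _
        _ = (e + |y|) * |g 1 y| + (e + |y|) * |P.derivative.eval y| := by ring
        _ ≤ A₁ + A₂ := by linarith

open MeasureTheory

/-- Lebesgue measure on `(-1, 1]`. -/
noncomputable abbrev volUnit : Measure ℝ := volume.restrict (Set.Ioc (-1) 1)

/-- Continuous on `[-1, 1]` and, off a countable set, differentiable with bounded derivative. -/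
def IsPiecewiseC1 (v : ℝ → ℝ) : Prop :=
  ContinuousOn v (Set.Icc (-1) 1) ∧ ∃ S : Set ℝ, S.Countable ∧ ∃ M : ℝ,
    ∀ y ∈ Set.Ioo (-1 : ℝ) 1 \ S, DifferentiableAt ℝ v y ∧ |deriv v y| ≤ M

lemma intervalIntegral_eq_volUnit (f : ℝ → ℝ) :
    ∫ y in (-1 : ℝ)..1, f y = ∫ y, f y ∂volUnit :=
  intervalIntegral.integral_of_le (by norm_num)

lemma ae_volUnit_of_forall_diff {S : Set ℝ} (hS : S.Countable) {P : ℝ → Prop}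
    (h : ∀ y ∈ Set.Ioo (-1 : ℝ) 1 \ S, P y) : ∀ᵐ y ∂volUnit, P y := by
  rw [ae_restrict_iff' measurableSet_Ioc]
  have h1 : ∀ᵐ y : ℝ, y ∉ S := (hS.ae_notMem volume)
  have h2 : ∀ᵐ y : ℝ, y ≠ 1 := by simp [ae_iff]
  filter_upwards [h1, h2] with y hy1 hy2 hy
  exact h y ⟨⟨hy.1, lt_of_le_of_ne hy.2 hy2⟩, hy1⟩

lemma ae_volUnit_of_forall {P : ℝ → Prop} (h : ∀ y ∈ Set.Ioo (-1 : ℝ) 1, P y) :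
    ∀ᵐ y ∂volUnit, P y :=
  ae_volUnit_of_forall_diff Set.countable_empty fun y hy => h y hy.1

lemma ContinuousOn.memLp_top_volUnit {f : ℝ → ℝ} (hf : ContinuousOn f (Set.Icc (-1) 1)) :
    MemLp f ⊤ volUnit := by
  obtain ⟨C, hC⟩ := isCompact_Icc.exists_bound_of_continuousOn hf
  refine memLp_top_of_bound
    ((hf.mono Set.Ioc_subset_Icc_self).aestronglyMeasurable measurableSet_Ioc) C ?_
  exact ae_volUnit_of_forall fun y hy => hC y ⟨hy.1.le, hy.2.le⟩

lemma MeasureTheory.MemLp.mul_top {f g : ℝ → ℝ} (hf : MemLp f ⊤ volUnit) (hg : MemLp g ⊤ volUnit) :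
    MemLp (fun y => f y * g y) ⊤ volUnit :=
  hg.mul' hf

lemma integrable_of_memLp_top {f : ℝ → ℝ} (hf : MemLp f ⊤ volUnit) : Integrable f volUnit :=
  hf.integrable le_top

lemma integral_eq_zero_of_hasDerivAt {F F' : ℝ → ℝ} {S : Set ℝ} (hS : S.Countable)
    (hF : ContinuousOn F (Set.Icc (-1) 1))
    (hd : ∀ y ∈ Set.Ioo (-1 : ℝ) 1 \ S, HasDerivAt F (F' y) y) (hF' : MemLp F' ⊤ volUnit)
    (h0 : F (-1) = 0) (h1 : F 1 = 0) : ∫ y, F' y ∂volUnit = 0 := by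
  have hint : IntervalIntegrable F' volume (-1) 1 :=
    (intervalIntegrable_iff_integrableOn_Ioc_of_le (by norm_num)).2 (integrable_of_memLp_top hF')
  rw [← intervalIntegral_eq_volUnit,
    integral_eq_of_hasDerivAt_off_countable_of_le F F' (by norm_num) hS hF hd hint, h0, h1,
    sub_zero]

namespace IsPiecewiseC1

variable {v w : ℝ → ℝ}

lemma memLp (hv : IsPiecewiseC1 v) : MemLp v ⊤ volUnit := hv.1.memLp_top_volUnit

lemma memLp_deriv (hv : IsPiecewiseC1 v) : MemLp (deriv v) ⊤ volUnit := by
  obtain ⟨-, S, hS, M, hM⟩ := hv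
  exact memLp_top_of_bound (stronglyMeasurable_deriv v).aestronglyMeasurable M
    (ae_volUnit_of_forall_diff hS fun y hy => (hM y hy).2)

lemma ae_differentiableAt (hv : IsPiecewiseC1 v) : ∀ᵐ y ∂volUnit, DifferentiableAt ℝ v y := by
  obtain ⟨-, S, hS, M, hM⟩ := hv
  exact ae_volUnit_of_forall_diff hS fun y hy => (hM y hy).1

lemma sub (hv : IsPiecewiseC1 v) (hw : IsPiecewiseC1 w) :
    IsPiecewiseC1 (fun y => v y - w y) := by
  obtain ⟨hvc, S, hS, M, hM⟩ := hv
  obtain ⟨hwc, T, hT, L, hL⟩ := hw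
  refine ⟨hvc.sub hwc, S ∪ T, hS.union hT, M + L, fun y hy => ?_⟩
  have h1 := hM y ⟨hy.1, fun h => hy.2 (Or.inl h)⟩
  have h2 := hL y ⟨hy.1, fun h => hy.2 (Or.inr h)⟩
  refine ⟨h1.1.sub h2.1, ?_⟩
  rw [deriv_fun_sub h1.1 h2.1]
  exact (abs_sub _ _).trans (add_le_add h1.2 h2.2)

lemma ae_deriv_sub (hv : IsPiecewiseC1 v) (hw : IsPiecewiseC1 w) :
    ∀ᵐ y ∂volUnit, deriv (fun y => v y - w y) y = deriv v y - deriv w y := by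
  filter_upwards [hv.ae_differentiableAt, hw.ae_differentiableAt] with y h1 h2
  exact deriv_fun_sub h1 h2

end IsPiecewiseC1

section Energy

variable {ε : ℝ} {a c v w z : ℝ → ℝ}

lemma memLp_Beps_integrand (ha : ContinuousOn a (Set.Icc (-1) 1))
    (hc : ContinuousOn c (Set.Icc (-1) 1)) (hv : IsPiecewiseC1 v) (hw : IsPiecewiseC1 w) :
    MemLp (fun y => ε * (deriv v y * deriv w y) + a y * deriv v y * w y + c y * v y * w y)
      ⊤ volUnit :=
  (((hv.memLp_deriv.mul_top hw.memLp_deriv).const_mul ε).add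
    ((ha.memLp_top_volUnit.mul_top hv.memLp_deriv).mul_top hw.memLp)).add
    ((hc.memLp_top_volUnit.mul_top hv.memLp).mul_top hw.memLp)

lemma Beps_eq_integral (ha : ContinuousOn a (Set.Icc (-1) 1))
    (hc : ContinuousOn c (Set.Icc (-1) 1)) (hv : IsPiecewiseC1 v) (hw : IsPiecewiseC1 w) :
    Beps ε a c v w =
      ∫ y, (ε * (deriv v y * deriv w y) + a y * deriv v y * w y + c y * v y * w y) ∂volUnit := by
  have h1 := integrable_of_memLp_top ((hv.memLp_deriv.mul_top hw.memLp_deriv).const_mul ε)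
  have h2 := integrable_of_memLp_top
    ((ha.memLp_top_volUnit.mul_top hv.memLp_deriv).mul_top hw.memLp)
  have h3 := integrable_of_memLp_top ((hc.memLp_top_volUnit.mul_top hv.memLp).mul_top hw.memLp)
  have h12 : Integrable (fun y => ε * (deriv v y * deriv w y) + a y * deriv v y * w y) volUnit :=
    h1.add h2
  rw [Beps, integral_add h12 h3, integral_add h1 h2, integral_const_mul]
  simp only [intervalIntegral_eq_volUnit]

lemma Beps_sub_left (ha : ContinuousOn a (Set.Icc (-1) 1))
    (hc : ContinuousOn c (Set.Icc (-1) 1)) (hv : IsPiecewiseC1 v) (hw : IsPiecewiseC1 w)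
    (hz : IsPiecewiseC1 z) :
    Beps ε a c (fun y => v y - w y) z = Beps ε a c v z - Beps ε a c w z := by
  rw [Beps_eq_integral ha hc (hv.sub hw) hz, Beps_eq_integral ha hc hv hz,
    Beps_eq_integral ha hc hw hz,
    ← integral_sub (integrable_of_memLp_top (memLp_Beps_integrand ha hc hv hz))
      (integrable_of_memLp_top (memLp_Beps_integrand ha hc hw hz))]
  refine integral_congr_ae ?_
  filter_upwards [hv.ae_deriv_sub hw] with y hy
  rw [hy]
  ring

/-- The squared energy density of a piecewise `C¹` function is bounded. -/
lemma memLp_energy_integrand (hv : IsPiecewiseC1 v) :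
    MemLp (fun y => ε * (deriv v y) ^ 2 + (v y) ^ 2) ⊤ volUnit := by
  simp only [sq]
  exact ((hv.memLp_deriv.mul_top hv.memLp_deriv).const_mul ε).add (hv.memLp.mul_top hv.memLp)

lemma energyNorm_eq (hv : IsPiecewiseC1 v) :
    energyNorm ε v = Real.sqrt (∫ y, (ε * (deriv v y) ^ 2 + (v y) ^ 2) ∂volUnit) := by
  have h1 : Integrable (fun y => ε * (deriv v y) ^ 2) volUnit := by
    simp only [sq]
    exact integrable_of_memLp_top ((hv.memLp_deriv.mul_top hv.memLp_deriv).const_mul ε)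
  have h2 : Integrable (fun y => (v y) ^ 2) volUnit := by
    simp only [sq]
    exact integrable_of_memLp_top (hv.memLp.mul_top hv.memLp)
  rw [energyNorm, integral_add h1 h2, integral_const_mul]
  simp only [intervalIntegral_eq_volUnit]

/-- Coercivity of the bilinear form on functions vanishing at the endpoints. -/
lemma energy_le_Beps_self {m : ℝ} (hε : 0 < ε) (hm1 : m ≤ 1)
    (ha : ContDiffOn ℝ 1 a (Set.Icc (-1) 1)) (hc : ContinuousOn c (Set.Icc (-1) 1))
    (hcoer : ∀ y ∈ Set.Icc (-1 : ℝ) 1, m ≤ c y - derivWithin a (Set.Icc (-1) 1) y / 2)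
    (hv : IsPiecewiseC1 v) (hv0 : v (-1) = 0) (hv1 : v 1 = 0) :
    m * ∫ y, (ε * (deriv v y) ^ 2 + (v y) ^ 2) ∂volUnit ≤ Beps ε a c v v := by
  have hu : UniqueDiffOn ℝ (Set.Icc (-1 : ℝ) 1) := uniqueDiffOn_Icc (by norm_num)
  have ha' := ha.continuousOn_derivWithin hu le_rfl
  have hac := ha.continuousOn
  set a' := derivWithin a (Set.Icc (-1) 1) with ha'_def
  have hmem : MemLp (fun y => a' y * (v y * v y) + a y * (2 * (v y * deriv v y))) ⊤ volUnit :=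
    (ha'.memLp_top_volUnit.mul_top (hv.memLp.mul_top hv.memLp)).add
      (hac.memLp_top_volUnit.mul_top ((hv.memLp.mul_top hv.memLp_deriv).const_mul 2))
  have hzero : ∫ y, (a' y * (v y * v y) + a y * (2 * (v y * deriv v y))) ∂volUnit = 0 := by
    obtain ⟨hvc, S, hS, M, hM⟩ := hv
    refine integral_eq_zero_of_hasDerivAt (F := fun y => a y * (v y * v y)) hS
      (hac.mul (hvc.mul hvc)) (fun y hy => ?_) hmem (by simp [hv0]) (by simp [hv1])
    have h1 : HasDerivAt a (a' y) y :=
      (ha.differentiableOn one_ne_zero y ⟨hy.1.1.le, hy.1.2.le⟩).hasDerivWithinAt.hasDerivAt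
        (Icc_mem_nhds hy.1.1 hy.1.2)
    have h2 := (hM y hy).1.hasDerivAt
    refine (h1.mul (h2.mul h2)).congr_deriv ?_
    simp only [Pi.mul_apply]
    ring
  have hB := memLp_Beps_integrand (ε := ε) hac hc hv hv
  have heq : Beps ε a c v v = ∫ y, ((ε * (deriv v y * deriv v y) + a y * deriv v y * v y
      + c y * v y * v y) - 1 / 2 * (a' y * (v y * v y) + a y * (2 * (v y * deriv v y))))
      ∂volUnit := by
    rw [integral_sub (integrable_of_memLp_top hB)
      (integrable_of_memLp_top (hmem.const_mul (1 / 2))), integral_const_mul, hzero,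
      Beps_eq_integral hac hc hv hv]
    ring
  rw [heq, ← integral_const_mul]
  refine integral_mono_ae
    (integrable_of_memLp_top ((memLp_energy_integrand hv).const_mul m))
    (integrable_of_memLp_top (hB.sub (hmem.const_mul (1 / 2)))) ?_
  refine ae_volUnit_of_forall fun y hy => ?_
  have h1 := hcoer y ⟨hy.1.le, hy.2.le⟩
  have h2 : 0 ≤ ε * (deriv v y) ^ 2 := by positivity
  have h3 := mul_le_mul_of_nonneg_right h1 (sq_nonneg (v y))
  have h4 := mul_le_mul_of_nonneg_right hm1 h2
  simp only
  nlinarith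

/-- The discrete error is controlled by a weighted interpolation error. -/
lemma energy_le_of_orthogonal {m : ℝ} (hε : 0 < ε) (hm : 0 < m) (hm1 : m ≤ 1)
    (ha : ContDiffOn ℝ 1 a (Set.Icc (-1) 1)) (hc : ContinuousOn c (Set.Icc (-1) 1))
    (hcoer : ∀ y ∈ Set.Icc (-1 : ℝ) 1, m ≤ c y - derivWithin a (Set.Icc (-1) 1) y / 2)
    (hv : IsPiecewiseC1 v) (hv0 : v (-1) = 0) (hv1 : v 1 = 0) (hw : IsPiecewiseC1 w)
    (horth : Beps ε a c v v + Beps ε a c w v = 0) {W : ℝ → ℝ} (hW : Integrable W volUnit)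
    (hwW : ∀ᵐ y ∂volUnit,
      ε * (deriv w y) ^ 2 + (a y * deriv w y) ^ 2 + (c y * w y) ^ 2 ≤ W y) :
    ∫ y, (ε * (deriv v y) ^ 2 + (v y) ^ 2) ∂volUnit ≤ 2 / m ^ 2 * ∫ y, W y ∂volUnit := by
  have h1 := energy_le_Beps_self hε hm1 ha hc hcoer hv hv0 hv1
  have hE := integrable_of_memLp_top (memLp_energy_integrand (ε := ε) hv)
  have h2 : -Beps ε a c w v ≤ m / 2 * (∫ y, (ε * (deriv v y) ^ 2 + (v y) ^ 2) ∂volUnit)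
      + 1 / m * ∫ y, W y ∂volUnit := by
    rw [Beps_eq_integral ha.continuousOn hc hw hv, ← integral_neg, ← integral_const_mul,
      ← integral_const_mul, ← integral_add (hE.const_mul _) (hW.const_mul _)]
    refine integral_mono_ae
      (integrable_of_memLp_top (memLp_Beps_integrand ha.continuousOn hc hw hv)).neg
      ((hE.const_mul _).add (hW.const_mul _)) ?_
    filter_upwards [hwW] with y hy
    have young : ∀ A B : ℝ, -(A * B) ≤ m / 4 * A ^ 2 + 1 / m * B ^ 2 := by
      intro A B
      have : m / 4 * A ^ 2 + 1 / m * B ^ 2 + A * B = (m * A / 2 + B) ^ 2 / m := by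
        field_simp
        ring
      have : 0 ≤ (m * A / 2 + B) ^ 2 / m := by positivity
      linarith
    have y1 := mul_le_mul_of_nonneg_left (young (deriv v y) (deriv w y)) hε.le
    have y2 := young (v y) (a y * deriv w y)
    have y3 := young (v y) (c y * w y)
    have y4 := mul_le_mul_of_nonneg_left hy (by positivity : 0 ≤ 1 / m)
    have y5 : 0 ≤ m * (ε * (deriv v y) ^ 2) := by positivity
    nlinarith
  have h3 : m / 2 * (∫ y, (ε * (deriv v y) ^ 2 + (v y) ^ 2) ∂volUnit)
      ≤ 1 / m * ∫ y, W y ∂volUnit := by linarith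
  have h4 := mul_le_mul_of_nonneg_left h3 (by positivity : 0 ≤ 2 / m)
  have e1 : ∀ X : ℝ, 2 / m * (m / 2 * X) = X := by intro X; field_simp
  have e2 : ∀ X : ℝ, 2 / m * (1 / m * X) = 2 / m ^ 2 * X := by intro X; field_simp
  rwa [e1, e2] at h4

lemma energy_sub_le {x : ℝ → ℝ} (hε : 0 < ε) (hv : IsPiecewiseC1 v) (hw : IsPiecewiseC1 w)
    (hx : IsPiecewiseC1 x) :
    ∫ y, (ε * (deriv (fun y => v y - w y) y) ^ 2 + (v y - w y) ^ 2) ∂volUnit ≤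
      2 * (∫ y, (ε * (deriv (fun y => v y - x y) y) ^ 2 + (v y - x y) ^ 2) ∂volUnit)
      + 2 * ∫ y, (ε * (deriv (fun y => x y - w y) y) ^ 2 + (x y - w y) ^ 2) ∂volUnit := by
  have i1 := integrable_of_memLp_top (memLp_energy_integrand (ε := ε) (hv.sub hx))
  have i2 := integrable_of_memLp_top (memLp_energy_integrand (ε := ε) (hx.sub hw))
  rw [← integral_const_mul, ← integral_const_mul,
    ← integral_add (i1.const_mul 2) (i2.const_mul 2)]
  refine integral_mono_ae (integrable_of_memLp_top (memLp_energy_integrand (hv.sub hw)))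
    ((i1.const_mul 2).add (i2.const_mul 2)) ?_
  filter_upwards [hv.ae_deriv_sub hw, hv.ae_deriv_sub hx, hx.ae_deriv_sub hw] with y h1 h2 h3
  simp only [h1, h2, h3]
  have key : ∀ A B D : ℝ, (A - B) ^ 2 ≤ 2 * (A - D) ^ 2 + 2 * (D - B) ^ 2 := by
    intro A B D
    nlinarith [sq_nonneg (A - D - (D - B))]
  have k1 := mul_le_mul_of_nonneg_left (key (deriv v y) (deriv w y) (deriv x y)) hε.le
  have k2 := key (v y) (w y) (x y)
  linarith

end Energy

section MeshFunctions

variable {x : ℤ → ℝ} {N k : ℕ}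

lemma exists_cell_mem (hN : 1 ≤ N) (h0 : x (-N) = -1) (h1 : x N = 1) {y : ℝ}
    (hy : y ∈ Set.Icc (-1 : ℝ) 1) :
    ∃ i : ℤ, -(N : ℤ) < i ∧ i ≤ N ∧ y ∈ Set.Icc (x (i - 1)) (x i) := by
  have key : ∀ n : ℕ, n + 1 ≤ 2 * N → y ≤ x (-N + (n + 1 : ℕ)) →
      ∃ i : ℤ, -(N : ℤ) < i ∧ i ≤ N ∧ y ∈ Set.Icc (x (i - 1)) (x i) := by
    intro n
    induction n with
    | zero =>
      intro hn hyn
      refine ⟨-N + (0 + 1 : ℕ), by simp, by push_cast; omega, ?_, hyn⟩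
      simpa [h0] using hy.1
    | succ n ih =>
      intro hn hyn
      rcases le_total y (x (-N + (n + 1 : ℕ))) with h | h
      · exact ih (by omega) h
      · refine ⟨-N + (n + 1 + 1 : ℕ), by push_cast; omega, by push_cast; omega, ?_, hyn⟩
        rwa [show -(N : ℤ) + (n + 1 + 1 : ℕ) - 1 = -N + (n + 1 : ℕ) by push_cast; ring]
  refine key (2 * N - 1) (by omega) ?_
  rw [show -(N : ℤ) + (2 * N - 1 + 1 : ℕ) = N by omega, h1]
  exact hy.2

lemma hasDerivAt_of_eq_polynomial {v : ℝ → ℝ} {P : Polynomial ℝ} {p q y : ℝ}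
    (h : ∀ y ∈ Set.Icc p q, v y = P.eval y) (hy : y ∈ Set.Ioo p q) :
    HasDerivAt v (P.derivative.eval y) y := by
  refine (P.hasDerivAt y).congr_of_eventuallyEq ?_
  filter_upwards [Icc_mem_nhds hy.1 hy.2] with z hz using h z hz

/-- Off the mesh points, every point of `(-1, 1)` is interior to some mesh cell. -/
lemma exists_cell_mem_Ioo (hN : 1 ≤ N) (h0 : x (-N) = -1) (h1 : x N = 1) {y : ℝ}
    (hy : y ∈ Set.Ioo (-1 : ℝ) 1 \ Set.range x) :
    ∃ i : ℤ, -(N : ℤ) < i ∧ i ≤ N ∧ y ∈ Set.Ioo (x (i - 1)) (x i) := by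
  obtain ⟨i, hi, hiN, hyi⟩ := exists_cell_mem hN h0 h1 (Set.Ioo_subset_Icc_self hy.1)
  exact ⟨i, hi, hiN, lt_of_le_of_ne hyi.1 fun h => hy.2 ⟨_, h⟩,
    lt_of_le_of_ne hyi.2 fun h => hy.2 ⟨_, h.symm⟩⟩

lemma MemVN.isPiecewiseC1 {v : ℝ → ℝ} (hN : 1 ≤ N) (h0 : x (-N) = -1) (h1 : x N = 1)
    (hv : MemVN x N k v) : IsPiecewiseC1 v := by
  obtain ⟨hvc, -, -, hpoly⟩ := hv
  have hbd : ∀ i : ℤ, ∃ M : ℝ, 0 ≤ M ∧ (-(N : ℤ) < i → i ≤ N →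
      ∀ y ∈ Set.Ioo (x (i - 1)) (x i), DifferentiableAt ℝ v y ∧ |deriv v y| ≤ M) := by
    intro i
    by_cases hi : -(N : ℤ) < i ∧ i ≤ N
    · obtain ⟨P, -, hP⟩ := hpoly i hi.1 hi.2
      obtain ⟨M, hM⟩ := (isCompact_Icc (a := x (i - 1)) (b := x i)).exists_bound_of_continuousOn
        P.derivative.continuous.continuousOn
      refine ⟨|M|, abs_nonneg M, fun _ _ y hy => ?_⟩
      have hd := hasDerivAt_of_eq_polynomial hP hy
      refine ⟨hd.differentiableAt, ?_⟩
      rw [hd.deriv]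
      exact (hM y (Set.Ioo_subset_Icc_self hy)).trans (le_abs_self M)
    · exact ⟨0, le_rfl, fun h h' => absurd ⟨h, h'⟩ hi⟩
  choose M hM0 hM using hbd
  refine ⟨hvc, Set.range x, Set.countable_range x, ∑ i ∈ Finset.Ioc (-(N : ℤ)) N, M i,
    fun y hy => ?_⟩
  obtain ⟨i, hi, hiN, hyi⟩ := exists_cell_mem_Ioo hN h0 h1 hy
  obtain ⟨hd, hb⟩ := hM i hi hiN y hyi
  exact ⟨hd, hb.trans (Finset.single_le_sum (fun j _ => hM0 j) (Finset.mem_Ioc.2 ⟨hi, hiN⟩))⟩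

lemma MemVN.sub {v w : ℝ → ℝ} (hv : MemVN x N k v) (hw : MemVN x N k w) :
    MemVN x N k (fun y => v y - w y) := by
  obtain ⟨hvc, hv0, hv1, hvp⟩ := hv
  obtain ⟨hwc, hw0, hw1, hwp⟩ := hw
  refine ⟨hvc.sub hwc, by simp [hv0, hw0], by simp [hv1, hw1], fun i hi hiN => ?_⟩
  obtain ⟨P, hPd, hP⟩ := hvp i hi hiN
  obtain ⟨Q, hQd, hQ⟩ := hwp i hi hiN
  refine ⟨P - Q, (Polynomial.natDegree_sub_le _ _).trans (max_le hPd hQd), fun y hy => ?_⟩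
  simp only [hP y hy, hQ y hy, Polynomial.eval_sub]

/-- Cellwise polynomials interpolating `u` at the mesh points glue to a mesh function. -/
lemma exists_memVN_of_cells {u : ℝ → ℝ} (hN : 1 ≤ N) (h0 : x (-N) = -1) (h1 : x N = 1)
    (hu0 : u (-1) = 0) (hu1 : u 1 = 0)
    (hlt : ∀ i : ℤ, -(N : ℤ) < i → i ≤ N → x (i - 1) < x i) (P : ℤ → Polynomial ℝ)
    (hP : ∀ i : ℤ, -(N : ℤ) < i → i ≤ N → (P i).natDegree ≤ k ∧
      (P i).eval (x (i - 1)) = u (x (i - 1)) ∧ (P i).eval (x i) = u (x i)) :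
    ∃ w : ℝ → ℝ, MemVN x N k w ∧ ∀ i : ℤ, -(N : ℤ) < i → i ≤ N →
      ∀ y ∈ Set.Icc (x (i - 1)) (x i), w y = (P i).eval y := by
  classical
  have hmono : ∀ (n : ℕ) (i : ℤ), -(N : ℤ) ≤ i → i + n ≤ N → x i ≤ x (i + n) := by
    intro n
    induction n with
    | zero => intro i _ _; simp
    | succ n ih =>
      intro i hi hin
      refine (ih i hi (by push_cast at hin; omega)).trans ?_
      have := hlt (i + (n + 1 : ℕ)) (by push_cast; omega) hin
      rw [show i + ((n + 1 : ℕ) : ℤ) - 1 = i + n by push_cast; ring] at this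
      exact this.le
  have hmono' : ∀ i j : ℤ, -(N : ℤ) ≤ i → i ≤ j → j ≤ N → x i ≤ x j := by
    intro i j hi hij hj
    obtain ⟨n, rfl⟩ := Int.le.dest hij
    exact hmono n i hi hj
  have hagree : ∀ i j : ℤ, -(N : ℤ) < i → i < j → j ≤ N → ∀ y ∈ Set.Icc (x (i - 1)) (x i),
      y ∈ Set.Icc (x (j - 1)) (x j) → (P i).eval y = (P j).eval y := by
    intro i j hi hij hj y hyi hyj
    have hle := hmono' i (j - 1) hi.le (by omega) (by omega)
    have e1 : y = x i := le_antisymm hyi.2 (hle.trans hyj.1)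
    have e2 : y = x (j - 1) := le_antisymm (hyi.2.trans hle) hyj.1
    rw [show (P i).eval y = u y by rw [e1]; exact (hP i hi (by omega)).2.2,
      show (P j).eval y = u y by rw [e2]; exact (hP j (by omega) hj).2.1]
  let w : ℝ → ℝ := fun y =>
    if h : ∃ i : ℤ, -(N : ℤ) < i ∧ i ≤ N ∧ y ∈ Set.Icc (x (i - 1)) (x i)
    then (P h.choose).eval y else 0
  have hw : ∀ i : ℤ, -(N : ℤ) < i → i ≤ N →
      ∀ y ∈ Set.Icc (x (i - 1)) (x i), w y = (P i).eval y := by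
    intro i hi hiN y hy
    have h : ∃ i : ℤ, -(N : ℤ) < i ∧ i ≤ N ∧ y ∈ Set.Icc (x (i - 1)) (x i) := ⟨i, hi, hiN, hy⟩
    have hwy : w y = (P h.choose).eval y := dif_pos h
    obtain ⟨hj, hjN, hyj⟩ := h.choose_spec
    rw [hwy]
    rcases lt_trichotomy h.choose i with hlt' | heq | hgt
    · exact hagree _ _ hj hlt' hiN y hyj hy
    · rw [heq]
    · exact (hagree _ _ hi hgt hjN y hy hyj).symm
  refine ⟨w, ⟨?_, ?_, ?_, fun i hi hiN => ⟨P i, (hP i hi hiN).1, hw i hi hiN⟩⟩, hw⟩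
  · have hcont : ContinuousOn w (⋃ i : Finset.Ioc (-(N : ℤ)) N, Set.Icc (x (i - 1)) (x i)) := by
      refine (locallyFinite_of_finite _).continuousOn_iUnion (fun i => isClosed_Icc) fun i => ?_
      have hi := Finset.mem_Ioc.1 i.2
      exact (P i).continuous.continuousOn.congr (hw i hi.1 hi.2)
    refine hcont.mono fun y hy => ?_
    obtain ⟨i, hi, hiN, hyi⟩ := exists_cell_mem hN h0 h1 hy
    exact Set.mem_iUnion.2 ⟨⟨i, Finset.mem_Ioc.2 ⟨hi, hiN⟩⟩, hyi⟩
  · have hl := hlt (-N + 1) (by omega) (by omega)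
    rw [add_sub_cancel_right] at hl
    have h := hP (-N + 1) (by omega) (by omega)
    rw [add_sub_cancel_right] at h
    rw [hw (-N + 1) (by omega) (by omega) (-1) ?_, ← h0, h.2.1, h0, hu0]
    rw [add_sub_cancel_right, ← h0]
    exact ⟨le_rfl, hl.le⟩
  · rw [hw N (by omega) le_rfl 1 ?_, ← h1, (hP N (by omega) le_rfl).2.2, h1, hu1]
    rw [← h1]
    exact ⟨(hlt N (by omega) le_rfl).le, le_rfl⟩

end MeshFunctions

lemma ContDiffOn.hasDerivWithinAt_iteratedDerivWithin {u : ℝ → ℝ} {n i : ℕ}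
    (hu : ContDiffOn ℝ n u (Set.Icc (-1) 1)) (hi : i < n) {y : ℝ}
    (hy : y ∈ Set.Icc (-1 : ℝ) 1) :
    HasDerivWithinAt (iteratedDerivWithin i u (Set.Icc (-1) 1))
      (iteratedDerivWithin (i + 1) u (Set.Icc (-1) 1) y) (Set.Icc (-1) 1) y := by
  rw [iteratedDerivWithin_succ]
  exact (hu.differentiableOn_iteratedDerivWithin (by exact_mod_cast hi)
    (uniqueDiffOn_Icc (by norm_num)) y hy).hasDerivWithinAt

lemma ContDiffOn.hasDerivAt_derivWithin {u : ℝ → ℝ}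
    (hu : ContDiffOn ℝ 1 u (Set.Icc (-1) 1)) {y : ℝ} (hy : y ∈ Set.Ioo (-1 : ℝ) 1) :
    HasDerivAt u (derivWithin u (Set.Icc (-1) 1) y) y :=
  (hu.differentiableOn one_ne_zero y (Set.Ioo_subset_Icc_self hy)).hasDerivWithinAt.hasDerivAt
    (Icc_mem_nhds hy.1 hy.2)

lemma ContDiffOn.isPiecewiseC1 {u : ℝ → ℝ} (hu : ContDiffOn ℝ 1 u (Set.Icc (-1) 1)) :
    IsPiecewiseC1 u := by
  obtain ⟨M, hM⟩ := isCompact_Icc.exists_bound_of_continuousOn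
    (hu.continuousOn_derivWithin (uniqueDiffOn_Icc (by norm_num)) le_rfl)
  refine ⟨hu.continuousOn, ∅, Set.countable_empty, M, fun y hy => ?_⟩
  have hd := hu.hasDerivAt_derivWithin hy.1
  refine ⟨hd.differentiableAt, ?_⟩
  rw [hd.deriv]
  exact hM y (Set.Ioo_subset_Icc_self hy.1)

/-- A classical solution satisfies the weak formulation. -/
lemma Beps_eq_of_solution {ε : ℝ} {a c f u v : ℝ → ℝ} (ha : ContinuousOn a (Set.Icc (-1) 1))
    (hc : ContinuousOn c (Set.Icc (-1) 1)) (hu : ContDiffOn ℝ 2 u (Set.Icc (-1) 1))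
    (hsol : ∀ y ∈ Set.Ioo (-1 : ℝ) 1,
      -ε * iteratedDerivWithin 2 u (Set.Icc (-1) 1) y
        + a y * derivWithin u (Set.Icc (-1) 1) y + c y * u y = f y)
    (hv : IsPiecewiseC1 v) (hv0 : v (-1) = 0) (hv1 : v 1 = 0) :
    Beps ε a c u v = ∫ y in (-1 : ℝ)..1, f y * v y := by
  have hud : UniqueDiffOn ℝ (Set.Icc (-1 : ℝ) 1) := uniqueDiffOn_Icc (by norm_num)
  have hu1 : ContDiffOn ℝ 1 u (Set.Icc (-1) 1) := hu.of_le (by norm_num)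
  have hup := hu1.isPiecewiseC1
  have hc1 := hu1.continuousOn_derivWithin hud le_rfl
  have hc2 : ContinuousOn (iteratedDerivWithin 2 u (Set.Icc (-1) 1)) (Set.Icc (-1) 1) :=
    hu.continuousOn_iteratedDerivWithin (by norm_num) hud
  set u' := derivWithin u (Set.Icc (-1) 1) with hu'
  set u'' := iteratedDerivWithin 2 u (Set.Icc (-1) 1) with hu''
  have hmem : MemLp (fun y => u'' y * v y + u' y * deriv v y) ⊤ volUnit :=
    (hc2.memLp_top_volUnit.mul_top hv.memLp).add (hc1.memLp_top_volUnit.mul_top hv.memLp_deriv)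
  have hzero : ∫ y, (u'' y * v y + u' y * deriv v y) ∂volUnit = 0 := by
    obtain ⟨hvc, S, hS, M, hM⟩ := hv
    refine integral_eq_zero_of_hasDerivAt (F := fun y => u' y * v y) hS
      (hc1.mul hvc) (fun y hy => ?_) hmem (by simp [hv0]) (by simp [hv1])
    have h1 : HasDerivAt u' (u'' y) y := by
      have := ContDiffOn.hasDerivWithinAt_iteratedDerivWithin (n := 2) (i := 1) hu (by norm_num)
        (Set.Ioo_subset_Icc_self hy.1)
      rw [iteratedDerivWithin_one] at this
      exact this.hasDerivAt (Icc_mem_nhds hy.1.1 hy.1.2)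
    exact h1.mul (hM y hy).1.hasDerivAt
  have hB := memLp_Beps_integrand (ε := ε) ha hc hup hv
  rw [Beps_eq_integral ha hc hup hv, intervalIntegral_eq_volUnit]
  have : ∫ y, f y * v y ∂volUnit = ∫ y, ((ε * (deriv u y * deriv v y) + a y * deriv u y * v y
      + c y * u y * v y) - ε * (u'' y * v y + u' y * deriv v y)) ∂volUnit := by
    refine integral_congr_ae (ae_volUnit_of_forall fun y hy => ?_)
    have hd : deriv u y = u' y := (hu1.hasDerivAt_derivWithin hy).deriv
    simp only
    rw [hd, ← hsol y hy]
    ring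
  rw [this, integral_sub (integrable_of_memLp_top hB)
    (integrable_of_memLp_top (hmem.const_mul ε)), integral_const_mul, hzero, mul_zero, sub_zero]

lemma integral_const_add_indicator_le (A δ : ℝ) (S : ℝ) (hA : 0 ≤ A) (hδ : 0 ≤ δ) :
    Integrable (fun y => S + (Set.Icc (-δ) δ).indicator (fun _ => A) y) volUnit ∧
      ∫ y, (S + (Set.Icc (-δ) δ).indicator (fun _ => A) y) ∂volUnit ≤ 2 * S + 2 * δ * A := by
  have hi : Integrable ((Set.Icc (-δ) δ).indicator (fun _ => A)) volUnit :=
    (integrable_const A).indicator measurableSet_Icc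
  refine ⟨(integrable_const S).add hi, ?_⟩
  rw [integral_add (integrable_const S) hi, integral_const, integral_indicator measurableSet_Icc,
    integral_const, measureReal_restrict_apply_univ, measureReal_restrict_apply_univ]
  have h1 : (volume : Measure ℝ).real (Set.Ioc (-1 : ℝ) 1) = 2 := by
    rw [Real.volume_real_Ioc_of_le (by norm_num)]; norm_num
  have h2 : volUnit.real (Set.Icc (-δ) δ) ≤ 2 * δ := by
    have : volUnit.real (Set.Icc (-δ) δ) ≤ (volume : Measure ℝ).real (Set.Icc (-δ) δ) :=
      ENNReal.toReal_mono (by simp) (Measure.restrict_apply_le _ _)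
    rw [Real.volume_real_Icc_of_le (by linarith)] at this
    linarith
  rw [h1]
  simp only [smul_eq_mul]
  nlinarith

lemma exists_abs_le_mul_abs {a : ℝ → ℝ} (ha : ContDiffOn ℝ 1 a (Set.Icc (-1) 1))
    (ha0 : a 0 = 0) : ∃ L : ℝ, 0 ≤ L ∧ ∀ y ∈ Set.Icc (-1 : ℝ) 1, |a y| ≤ L * |y| := by
  obtain ⟨L, hL⟩ := isCompact_Icc.exists_bound_of_continuousOn
    (ha.continuousOn_derivWithin (uniqueDiffOn_Icc (by norm_num)) le_rfl)
  have h0 : (0 : ℝ) ∈ Set.Icc (-1 : ℝ) 1 := by constructor <;> norm_num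
  refine ⟨L, (norm_nonneg _).trans (hL 0 h0), fun y hy => ?_⟩
  have := (convex_Icc (-1 : ℝ) 1).norm_image_sub_le_of_norm_derivWithin_le
    (ha.differentiableOn one_ne_zero) hL h0 hy
  simpa [ha0] using this

/-- Weighted interpolation error on the Liseikin mesh: some mesh function `w` matches `u` up to an
error that is of order `N ^ (-k)` in the weighted sense, outside a tiny set near the origin. -/
lemma exists_interpolant (k : ℕ) (hk : 1 ≤ k) (lam α Cu : ℝ)
    (hlam0 : 0 < lam) (hlam1 : lam < k + 1) (hCu : 0 < Cu) (hα0 : 0 < α)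
    (hα : α * (k + 1) ≤ lam) (hα' : α * (2 * (k + 1)) ≤ 1) :
    ∃ A K : ℝ, 0 < A ∧ 0 < K ∧ ∀ ε : ℝ, 0 < ε → ε ≤ 1 → ∀ N : ℕ, 1 ≤ N → ∀ u : ℝ → ℝ,
      ContDiffOn ℝ (k + 1 : ℕ) u (Set.Icc (-1) 1) → u (-1) = 0 → u 1 = 0 →
      (∀ i : ℕ, i ≤ k + 1 → ∀ y ∈ Set.Icc (-1 : ℝ) 1,
        |iteratedDerivWithin i u (Set.Icc (-1) 1) y|
          ≤ Cu * (1 + (ε ^ ((1 : ℝ) / 2) + |y|) ^ (lam - i))) →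
      ∃ w, MemVN (liseikinX α ε N) N k w ∧
        ∀ᵐ y ∂volUnit, ∃ β : ℝ,
          β ^ 2 ≤ A ^ 2 / (N : ℝ) ^ (2 * k) +
            (Set.Icc (-(K / (N : ℝ) ^ (2 * k))) (K / (N : ℝ) ^ (2 * k))).indicator
              (fun _ => A ^ 2) y ∧
          |u y - w y| ≤ β ∧
          (ε ^ ((1 : ℝ) / 2) + |y|) * |deriv (fun y => u y - w y) y| ≤ β := by
  have hkr : (1 : ℝ) ≤ k := by exact_mod_cast hk
  have hα1 : α ≤ 1 := by nlinarith
  have hK1 : (1 : ℝ) ≤ 2 ^ (1 / α) + 1 / α := by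
    have h1 : 1 ≤ 1 / α := (one_le_div hα0).2 hα1
    have h2 : (0 : ℝ) < 2 ^ (1 / α) := by positivity
    linarith
  set K : ℝ := 2 ^ (1 / α) + 1 / α with hK
  obtain ⟨A, hA, hcell⟩ := exists_cell_interp k hk lam α Cu K hlam0 hlam1 hα0 hα hCu hK1
  refine ⟨A, K, hA, by linarith, ?_⟩
  intro ε hε hε1 N hN u hu hu0 hu1 hbd
  have hm : ((2 * k : ℕ) : ℝ) * α ≤ 1 := by push_cast; nlinarith
  have hx1 : liseikinX α ε N N = 1 := liseikinX_natCast_self hα0 hε hN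
  have hx0 : liseikinX α ε N (-N) = -1 := by rw [liseikinX_neg hα0 hε, hx1]
  have hlayer : ∀ i : ℤ, -(N : ℤ) < i → i ≤ N → _ := fun i hi hiN =>
    exists_layerCell hα0 hα1 (2 * k) hm hε hε1 hN hi hiN
  have he : 0 < ε ^ ((1 : ℝ) / 2) := by positivity
  have he1 : ε ^ ((1 : ℝ) / 2) ≤ 1 := Real.rpow_le_one hε.le hε1 (by norm_num)
  set x := liseikinX α ε N with hx
  have hmono : ∀ n : ℕ, (n : ℤ) ≤ 2 * N → -1 ≤ x (-N + n) := by
    intro n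
    induction n with
    | zero => intro _; simp [hx0]
    | succ n ih =>
      intro hn
      have h := (hlayer (-N + (n + 1 : ℕ)) (by push_cast; omega) (by omega)).1
      rw [show -(N : ℤ) + (n + 1 : ℕ) - 1 = -N + n by push_cast; ring] at h
      exact (ih (by push_cast at hn; omega)).trans h.le
  have hge : ∀ i : ℤ, -(N : ℤ) ≤ i → i ≤ N → -1 ≤ x i := by
    intro i hi hiN
    have := hmono (i + N).toNat (by omega)
    rwa [show -(N : ℤ) + ((i + N).toNat : ℤ) = i by omega] at this
  have hle : ∀ i : ℤ, -(N : ℤ) ≤ i → i ≤ N → x i ≤ 1 := by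
    intro i hi hiN
    have h := hge (-i) (by omega) (by omega)
    rw [hx, liseikinX_neg hα0 hε] at h
    linarith
  have hP : ∀ i : ℤ, ∃ P : Polynomial ℝ, -(N : ℤ) < i → i ≤ N → P.natDegree ≤ k ∧
      P.eval (x (i - 1)) = u (x (i - 1)) ∧ P.eval (x i) = u (x i) ∧
      ∀ y ∈ Set.Icc (x (i - 1)) (x i), ∃ β : ℝ,
        (β = A / (N : ℝ) ^ k ∨ (|y| ≤ K * (1 / (N : ℝ) ^ (2 * k)) ∧ β = A)) ∧
        |u y - P.eval y| ≤ β ∧ (ε ^ ((1 : ℝ) / 2) + |y|) *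
          |iteratedDerivWithin 1 u (Set.Icc (-1) 1) y - P.derivative.eval y| ≤ β := by
    intro i
    by_cases hi : -(N : ℤ) < i ∧ i ≤ N
    · obtain ⟨h1, h2⟩ := hlayer i hi.1 hi.2
      have hp := hge (i - 1) (by omega) (by omega)
      have hq := hle i hi.1.le hi.2
      have hsub : Set.Icc (x (i - 1)) (x i) ⊆ Set.Icc (-1) 1 := Set.Icc_subset_Icc hp hq
      obtain ⟨P, hPd, hPp, hPq, hPe⟩ := hcell _ _ N _ _
        (fun i => iteratedDerivWithin i u (Set.Icc (-1) 1)) he he1 hN h1 hp hq h2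
        (fun j hj y hy =>
          (hu.hasDerivWithinAt_iteratedDerivWithin (by omega) (hsub hy)).mono hsub)
        (fun j hj y hy => hbd j hj y (hsub hy))
      simp only [iteratedDerivWithin_zero] at hPp hPq hPe
      exact ⟨P, fun _ _ => ⟨hPd, hPp, hPq, hPe⟩⟩
    · exact ⟨0, fun h h' => absurd ⟨h, h'⟩ hi⟩
  choose P hP using hP
  obtain ⟨w, hw, hwP⟩ := exists_memVN_of_cells hN hx0 hx1 hu0 hu1
    (fun i hi hiN => (hlayer i hi hiN).1) P
    (fun i hi hiN => ⟨(hP i hi hiN).1, (hP i hi hiN).2.1, (hP i hi hiN).2.2.1⟩)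
  refine ⟨w, hw, ae_volUnit_of_forall_diff (Set.countable_range x) fun y hy => ?_⟩
  obtain ⟨i, hi, hiN, hyi⟩ := exists_cell_mem_Ioo hN hx0 hx1 hy
  have hyi' := Set.Ioo_subset_Icc_self hyi
  obtain ⟨β, hβ, hb1, hb2⟩ := (hP i hi hiN).2.2.2 y hyi'
  refine ⟨β, ?_, ?_, ?_⟩
  · rcases hβ with rfl | ⟨hyK, rfl⟩
    · rw [div_pow, ← pow_mul, mul_comm k 2]
      refine le_add_of_nonneg_right (Set.indicator_nonneg (fun _ _ => by positivity) _)
    · rw [mul_one_div] at hyK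
      rw [Set.indicator_of_mem (Set.mem_Icc.2 (abs_le.1 hyK))]
      exact le_add_of_nonneg_left (by positivity)
  · rw [hwP i hi hiN y hyi']
    exact hb1
  · have hd1 := (hu.of_le (m := 1) (by norm_cast; omega)).hasDerivAt_derivWithin hy.1
    have hd2 := hasDerivAt_of_eq_polynomial (hwP i hi hiN) hyi
    rw [(hd1.fun_sub hd2).deriv]
    rwa [iteratedDerivWithin_one] at hb2

theorem energy_error_liseikin (k : ℕ) (hk : 1 ≤ k) (lam α Cu γ : ℝ)
    (hlam0 : 0 < lam) (hlam1 : lam < k + 1) (hCu : 0 < Cu) (hγ : 0 < γ)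
    (hα0 : 0 < α) (hα : α ≤ min (lam / (k+1)) (1 / (2*(k+1))))
    (a c f : ℝ → ℝ)
    (ha : ContDiffOn ℝ 1 a (Set.Icc (-1) 1)) (hc : ContDiffOn ℝ 1 c (Set.Icc (-1) 1))
    (hf : ContDiffOn ℝ 1 f (Set.Icc (-1) 1)) (ha0 : a 0 = 0)
    (hcoer : ∀ y ∈ Set.Icc (-1:ℝ) 1, γ ≤ c y - derivWithin a (Set.Icc (-1) 1) y / 2) :
    ∃ C : ℝ, 0 < C ∧
      ∀ ε : ℝ, 0 < ε → ε ≤ 1 → ∀ N : ℕ, 1 ≤ N →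
      ∀ u uN : ℝ → ℝ,
        ContDiffOn ℝ (k+1 : ℕ) u (Set.Icc (-1) 1) → u (-1) = 0 → u 1 = 0 →
        (∀ y ∈ Set.Ioo (-1:ℝ) 1,
          -ε * iteratedDerivWithin 2 u (Set.Icc (-1) 1) y
            + a y * derivWithin u (Set.Icc (-1) 1) y + c y * u y = f y) →
        (∀ i : ℕ, i ≤ k+1 → ∀ y ∈ Set.Icc (-1:ℝ) 1,
          |iteratedDerivWithin i u (Set.Icc (-1) 1) y|
            ≤ Cu * (1 + (ε ^ ((1:ℝ)/2) + |y|) ^ (lam - i))) →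
        MemVN (liseikinX α ε N) N k uN →
        (∀ v, MemVN (liseikinX α ε N) N k v →
          Beps ε a c uN v = ∫ y in (-1:ℝ)..1, f y * v y) →
        energyNorm ε (fun y => u y - uN y) ≤ C / (N:ℝ) ^ k := by
  have hk1 : (0 : ℝ) < (k : ℝ) + 1 := by positivity
  have hα1 : α * (k + 1) ≤ lam := (le_div_iff₀ hk1).1 (hα.trans (min_le_left _ _))
  have hα2 : α * (2 * (k + 1)) ≤ 1 :=
    (le_div_iff₀ (by positivity)).1 (hα.trans (min_le_right _ _))
  obtain ⟨A, K, hA, hK, hinterp⟩ :=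
    exists_interpolant k hk lam α Cu hlam0 hlam1 hCu hα0 hα1 hα2
  obtain ⟨L, hL0, hL⟩ := exists_abs_le_mul_abs ha ha0
  obtain ⟨G, hG⟩ := isCompact_Icc.exists_bound_of_continuousOn hc.continuousOn
  set m : ℝ := min 1 γ with hm
  have hm0 : 0 < m := lt_min one_pos hγ
  set Q : ℝ := 1 + L ^ 2 + G ^ 2 with hQ
  have hQ1 : 1 ≤ Q := by nlinarith [sq_nonneg L, sq_nonneg G]
  set Z : ℝ := (4 + 4 / m ^ 2) * (Q * (A ^ 2 * (2 + 2 * K))) with hZ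
  have hZ0 : 0 < Z := by positivity
  refine ⟨Real.sqrt Z, Real.sqrt_pos.2 hZ0, ?_⟩
  intro ε hε hε1 N hN u uN hu hu0 hu1 hsol hbd huN hgal
  have hNk : (0 : ℝ) < (N : ℝ) ^ (2 * k) := by
    have : (0 : ℝ) < N := by exact_mod_cast hN
    positivity
  obtain ⟨w, hw, hest⟩ := hinterp ε hε hε1 N hN u hu hu0 hu1 hbd
  have hx1 : liseikinX α ε N N = 1 := liseikinX_natCast_self hα0 hε hN
  have hx0 : liseikinX α ε N (-N) = -1 := by rw [liseikinX_neg hα0 hε, hx1]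
  have hup : IsPiecewiseC1 u := (hu.of_le (m := 1) (by norm_cast; omega)).isPiecewiseC1
  have hwp := hw.isPiecewiseC1 hN hx0 hx1
  have huNp := huN.isPiecewiseC1 hN hx0 hx1
  have hξ := hw.sub huN
  have hξp := hwp.sub huNp
  have horth : Beps ε a c (fun y => w y - uN y) (fun y => w y - uN y)
      + Beps ε a c (fun y => u y - w y) (fun y => w y - uN y) = 0 := by
    rw [Beps_sub_left ha.continuousOn hc.continuousOn hwp huNp hξp,
      Beps_sub_left ha.continuousOn hc.continuousOn hup hwp hξp, hgal _ hξ,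
      Beps_eq_of_solution ha.continuousOn hc.continuousOn
        (hu.of_le (by norm_cast; omega)) hsol hξp hξ.2.1 hξ.2.2.1]
    ring
  set δ : ℝ := K / (N : ℝ) ^ (2 * k) with hδ
  obtain ⟨hWi, hWle⟩ := integral_const_add_indicator_le (A ^ 2) δ (A ^ 2 / (N : ℝ) ^ (2 * k))
    (by positivity) (by positivity)
  set W : ℝ → ℝ := fun y => A ^ 2 / (N : ℝ) ^ (2 * k)
    + (Set.Icc (-δ) δ).indicator (fun _ => A ^ 2) y with hW
  have he : 0 < ε ^ ((1 : ℝ) / 2) := by positivity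
  have hesq : (ε ^ ((1 : ℝ) / 2)) ^ 2 = ε := by
    rw [← Real.rpow_natCast, ← Real.rpow_mul hε.le]
    norm_num
  have hpt : ∀ᵐ y ∂volUnit, ∃ β : ℝ, β ^ 2 ≤ W y ∧ (u y - w y) ^ 2 ≤ β ^ 2 ∧
      ε * (deriv (fun y => u y - w y) y) ^ 2 ≤ β ^ 2 ∧
      (a y * deriv (fun y => u y - w y) y) ^ 2 ≤ L ^ 2 * β ^ 2 ∧
      (c y * (u y - w y)) ^ 2 ≤ G ^ 2 * β ^ 2 := by
    filter_upwards [hest, ae_volUnit_of_forall (P := fun y => |a y| ≤ L * |y| ∧ |c y| ≤ G)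
      fun y hy => ⟨hL y ⟨hy.1.le, hy.2.le⟩, hG y ⟨hy.1.le, hy.2.le⟩⟩] with y hy hy'
    obtain ⟨β, h1, h2, h3⟩ := hy
    obtain ⟨h4, h5⟩ := hy'
    have hβ0 : 0 ≤ β := (abs_nonneg _).trans h2
    generalize deriv (fun y => u y - w y) y = d at h3 ⊢
    have hd1 : ε ^ ((1 : ℝ) / 2) * |d| ≤ β :=
      (mul_le_mul_of_nonneg_right (by linarith [abs_nonneg y]) (abs_nonneg d)).trans h3
    have hd2 : |y| * |d| ≤ β :=
      (mul_le_mul_of_nonneg_right (by linarith) (abs_nonneg d)).trans h3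
    refine ⟨β, h1, ?_, ?_, ?_, ?_⟩
    · exact sq_le_sq.2 (by rwa [abs_of_nonneg hβ0])
    · rw [← hesq, ← mul_pow]
      refine sq_le_sq.2 ?_
      rwa [abs_mul, abs_of_pos he, abs_of_nonneg hβ0]
    · rw [← mul_pow]
      refine sq_le_sq.2 ?_
      rw [abs_mul, abs_of_nonneg (mul_nonneg hL0 hβ0)]
      calc |a y| * |d| ≤ L * |y| * |d| := by gcongr
        _ = L * (|y| * |d|) := by ring
        _ ≤ L * β := by gcongr
    · rw [← mul_pow]
      refine sq_le_sq.2 ?_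
      have hG0 : 0 ≤ G := (abs_nonneg _).trans h5
      rw [abs_mul, abs_of_nonneg (mul_nonneg hG0 hβ0)]
      exact mul_le_mul h5 h2 (abs_nonneg _) hG0
  have hηW : ∫ y, (ε * (deriv (fun y => u y - w y) y) ^ 2 + (u y - w y) ^ 2) ∂volUnit
      ≤ 2 * ∫ y, W y ∂volUnit := by
    rw [← integral_const_mul]
    refine integral_mono_ae (integrable_of_memLp_top (memLp_energy_integrand (hup.sub hwp)))
      (hWi.const_mul 2) ?_
    filter_upwards [hpt] with y hy
    obtain ⟨β, h1, h2, h3, -, -⟩ := hy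
    linarith
  have hξW := energy_le_of_orthogonal hε hm0 (min_le_left _ _) ha hc.continuousOn
    (fun y hy => (min_le_right _ _).trans (hcoer y hy)) hξp hξ.2.1 hξ.2.2.1 (hup.sub hwp) horth
    (hWi.const_mul Q) (by
      filter_upwards [hpt] with y hy
      obtain ⟨β, h1, h2, h3, h4, h5⟩ := hy
      have h6 := mul_le_mul_of_nonneg_left h1 (by linarith : 0 ≤ Q)
      have h7 : Q * β ^ 2 = β ^ 2 + L ^ 2 * β ^ 2 + G ^ 2 * β ^ 2 := by rw [hQ]; ring
      linarith)
  rw [integral_const_mul] at hξW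
  have hW0 : 0 ≤ ∫ y, W y ∂volUnit := integral_nonneg_of_ae (by
    filter_upwards [hpt] with y hy
    obtain ⟨β, h1, -⟩ := hy
    exact (sq_nonneg β).trans h1)
  have htotal := energy_sub_le hε hup huNp hwp
  have hmain : ∫ y, (ε * (deriv (fun y => u y - uN y) y) ^ 2 + (u y - uN y) ^ 2) ∂volUnit
      ≤ Z / (N : ℝ) ^ (2 * k) := by
    have hQW : ∫ y, W y ∂volUnit ≤ Q * ∫ y, W y ∂volUnit := le_mul_of_one_le_left hW0 hQ1
    have hWZ : Q * ∫ y, W y ∂volUnit ≤ Q * (A ^ 2 * (2 + 2 * K)) / (N : ℝ) ^ (2 * k) := by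
      calc Q * ∫ y, W y ∂volUnit
          ≤ Q * (2 * (A ^ 2 / (N : ℝ) ^ (2 * k)) + 2 * δ * A ^ 2) := by gcongr
        _ = _ := by rw [hδ]; ring
    calc ∫ y, (ε * (deriv (fun y => u y - uN y) y) ^ 2 + (u y - uN y) ^ 2) ∂volUnit
        ≤ (4 + 4 / m ^ 2) * (Q * ∫ y, W y ∂volUnit) := by
          have : 2 * (2 / m ^ 2 * (Q * ∫ y, W y ∂volUnit))
              = 4 / m ^ 2 * (Q * ∫ y, W y ∂volUnit) := by ring
          linarith
      _ ≤ (4 + 4 / m ^ 2) * (Q * (A ^ 2 * (2 + 2 * K)) / (N : ℝ) ^ (2 * k)) := by gcongr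
      _ = Z / (N : ℝ) ^ (2 * k) := by rw [hZ]; ring
  rw [energyNorm_eq (hup.sub huNp)]
  refine Real.sqrt_le_iff.2 ⟨by positivity, ?_⟩
  rwa [div_pow, Real.sq_sqrt hZ0.le, ← pow_mul, mul_comm k 2]
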